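/- arXiv:2510.18051 — 3 statements merged into one kernel-verified Lean document; each statement's English description precedes it below -/
import Mathlib

section
/- The group GL₂(ℤ) is generated by its two finite subgroups isomorphic to the dihedral groups D₈ (of order 8) and D₁₂ (of order 12), and is isomorphic to the amalgamated free product D₈ ∗_{C₂×C₂} D₁₂ over a common Klein four subgroup. -/
/-- The two-element family consisting of the dihedral groups of orders 8 and 12. -/
def Dfam : Bool → Type
  | true => DihedralGroup 4
  | false => DihedralGroup 6

instance : ∀ b, Group (Dfam b)
  | true => inferInstanceAs (Group (DihedralGroup 4))
  | false => inferInstanceAs (Group (DihedralGroup 6))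

open Matrix Monoid

namespace DihedralAmalgam

/-- The map sending the rotation `r i` to `a ^ i` and the reflection `sr i` to the coordinate
swap times `a ^ i`. -/
def dihedralRep (n : ℕ) (a : Matrix (Fin 2) (Fin 2) ℤ) :
    DihedralGroup n → Matrix (Fin 2) (Fin 2) ℤ
  | .r i => a ^ (i.cast : ℤ).toNat
  | .sr i => !![0, 1; 1, 0] * a ^ (i.cast : ℤ).toNat

/-- The symmetries of the square lattice fixing the origin, as integer matrices. -/
def squareRep : DihedralGroup 4 →* Matrix (Fin 2) (Fin 2) ℤ where
  toFun := dihedralRep 4 !![0, -1; 1, 0]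
  map_one' := by decide +kernel
  map_mul' := by decide +kernel

/-- The symmetries of the hexagonal lattice fixing the origin, as integer matrices. -/
def hexRep : DihedralGroup 6 →* Matrix (Fin 2) (Fin 2) ℤ where
  toFun := dihedralRep 6 !![0, -1; 1, 1]
  map_one' := by decide +kernel
  map_mul' := by decide +kernel

theorem squareRep_injective : Function.Injective squareRep := by
  unfold Function.Injective
  decide +kernel

theorem hexRep_injective : Function.Injective hexRep := by
  unfold Function.Injective
  decide +kernel

/-- The Klein four subgroup of the dihedral group of order 8 generated by `r 2` and `sr 0`. -/
def kleinSquare : Multiplicative (ZMod 2 × ZMod 2) →* DihedralGroup 4 where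
  toFun x := if x.toAdd.2 = 0 then .r (2 * x.toAdd.1.cast) else .sr (2 * x.toAdd.1.cast)
  map_one' := by decide +kernel
  map_mul' := by decide +kernel

/-- The Klein four subgroup of the dihedral group of order 12 generated by `r 3` and `sr 0`. -/
def kleinHex : Multiplicative (ZMod 2 × ZMod 2) →* DihedralGroup 6 where
  toFun x := if x.toAdd.2 = 0 then .r (3 * x.toAdd.1.cast) else .sr (3 * x.toAdd.1.cast)
  map_one' := by decide +kernel
  map_mul' := by decide +kernel

theorem kleinSquare_injective : Function.Injective kleinSquare := by
  unfold Function.Injective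
  decide +kernel

theorem kleinHex_injective : Function.Injective kleinHex := by
  unfold Function.Injective
  decide +kernel

theorem squareRep_kleinSquare (x : Multiplicative (ZMod 2 × ZMod 2)) :
    squareRep (kleinSquare x) = hexRep (kleinHex x) := by
  revert x
  decide +kernel

/-- The embeddings of the Klein four group into the two dihedral groups. -/
def klein : ∀ b, Multiplicative (ZMod 2 × ZMod 2) →* Dfam b
  | true => kleinSquare
  | false => kleinHex

theorem klein_injective : ∀ b, Function.Injective (klein b)
  | true => kleinSquare_injective
  | false => kleinHex_injective

/-- The representations of the two dihedral groups by integer matrices. -/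
def rep : ∀ b, Dfam b →* Matrix (Fin 2) (Fin 2) ℤ
  | true => squareRep
  | false => hexRep

theorem rep_injective : ∀ b, Function.Injective (rep b)
  | true => squareRep_injective
  | false => hexRep_injective

/-- The representations of the two dihedral groups as homomorphisms to `GL₂(ℤ)`. -/
def repGL (b : Bool) : Dfam b →* GL (Fin 2) ℤ := (rep b).toHomUnits

theorem repGL_injective (b : Bool) : Function.Injective (repGL b) := fun _ _ h =>
  rep_injective b (congrArg Units.val h)

theorem repGL_klein (b : Bool) : (repGL b).comp (klein b) = (repGL true).comp (klein true) := by
  refine MonoidHom.ext fun x => ?_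
  cases b
  · exact Units.ext (squareRep_kleinSquare x).symm
  · rfl

/-- The homomorphism from the amalgamated product to `GL₂(ℤ)`. -/
def amalgamHom : PushoutI klein →* GL (Fin 2) ℤ :=
  PushoutI.lift repGL _ repGL_klein

theorem amalgamHom_of (b : Bool) (g : Dfam b) :
    amalgamHom (PushoutI.of b g) = repGL b g :=
  PushoutI.lift_of _ _ _ _

theorem amalgamHom_base (b : Bool) (x : Multiplicative (ZMod 2 × ZMod 2)) :
    amalgamHom (PushoutI.base klein x) = repGL b (klein b x) := by
  rw [← PushoutI.of_apply_eq_base klein b, amalgamHom_of]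

/-- The matrices mapping `(1, 1)` and `(1, -1)` into the closed first and third quadrants
(for `true`) or the closed second and fourth quadrants (for `false`). -/
def InQuadrants (b : Bool) (m : Matrix (Fin 2) (Fin 2) ℤ) : Prop :=
  0 ≤ (if b then 1 else -1) * ((m 0 0 + m 0 1) * (m 1 0 + m 1 1)) ∧
    0 ≤ (if b then 1 else -1) * ((m 0 0 - m 0 1) * (m 1 0 - m 1 1))

instance (b : Bool) (m : Matrix (Fin 2) (Fin 2) ℤ) : Decidable (InQuadrants b m) :=
  inferInstanceAs (Decidable (_ ∧ _))

theorem not_inQuadrants_one (b : Bool) : ¬ InQuadrants b 1 := by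
  revert b
  decide +kernel

theorem squareRep_mem (g : DihedralGroup 4) (hg : ∀ x, kleinSquare x ≠ g) :
    squareRep g ∈ [!![0, -1; 1, 0], !![0, 1; -1, 0], !![1, 0; 0, -1], !![-1, 0; 0, 1]] := by
  revert g
  decide +kernel

theorem hexRep_mem (g : DihedralGroup 6) (hg : ∀ x, kleinHex x ≠ g) :
    hexRep g ∈ [!![0, -1; 1, 1], !![-1, -1; 1, 0], !![0, 1; -1, -1], !![1, 1; -1, 0],
      !![-1, 0; 1, 1], !![-1, -1; 0, 1], !![1, 0; -1, -1], !![1, 1; 0, -1]] := by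
  revert g
  decide +kernel

theorem InQuadrants.squareRep_mul {m : Matrix (Fin 2) (Fin 2) ℤ} (hm : InQuadrants false m)
    {g : DihedralGroup 4} (hg : ∀ x, kleinSquare x ≠ g) :
    InQuadrants true (squareRep g * m) := by
  have h := squareRep_mem g hg
  simp only [List.mem_cons, List.not_mem_nil, or_false] at h
  obtain ⟨h₁, h₂⟩ := hm
  simp only [InQuadrants, Bool.false_eq_true, if_false, if_true] at h₁ h₂ ⊢
  rcases h with h | h | h | h <;> rw [h] <;> simp [Matrix.mul_apply, Fin.sum_univ_two] <;>
    constructor <;> nlinarith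

theorem InQuadrants.hexRep_mul {m : Matrix (Fin 2) (Fin 2) ℤ} (hm : InQuadrants true m)
    {g : DihedralGroup 6} (hg : ∀ x, kleinHex x ≠ g) :
    InQuadrants false (hexRep g * m) := by
  have h := hexRep_mem g hg
  simp only [List.mem_cons, List.not_mem_nil, or_false] at h
  obtain ⟨h₁, h₂⟩ := hm
  simp only [InQuadrants, Bool.false_eq_true, if_false, if_true] at h₁ h₂ ⊢
  have s₁ := sq_nonneg (m 0 0 + m 0 1)
  have s₂ := sq_nonneg (m 1 0 + m 1 1)
  have s₃ := sq_nonneg (m 0 0 - m 0 1)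
  have s₄ := sq_nonneg (m 1 0 - m 1 1)
  rcases h with h | h | h | h | h | h | h | h <;> rw [h] <;>
    simp [Matrix.mul_apply, Fin.sum_univ_two] <;> constructor <;> nlinarith

theorem inQuadrants_squareRep_mul_hexRep :
    ∀ g : DihedralGroup 4, (∀ x, kleinSquare x ≠ g) →
      ∀ k : DihedralGroup 6, (∀ x, kleinHex x ≠ k) →
        InQuadrants true (squareRep g * hexRep k) ∧ InQuadrants false (hexRep k * squareRep g) := by
  decide +kernel

theorem InQuadrants.rep_mul {m : Matrix (Fin 2) (Fin 2) ℤ} {i j : Bool} (hij : j ≠ i)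
    (hm : InQuadrants j m) {g : Dfam i} (hg : g ∉ (klein i).range) :
    InQuadrants i (rep i g * m) := by
  have hg' : ∀ x, klein i x ≠ g := fun x hx => hg ⟨x, hx⟩
  match i, j, hij with
  | true, false, _ => exact hm.squareRep_mul hg'
  | false, true, _ => exact hm.hexRep_mul hg'

theorem inQuadrants_rep_mul_rep {i j : Bool} (hij : j ≠ i) {g : Dfam i}
    (hg : g ∉ (klein i).range) {k : Dfam j} (hk : k ∉ (klein j).range) :
    InQuadrants i (rep i g * rep j k) := by
  have hg' : ∀ x, klein i x ≠ g := fun x hx => hg ⟨x, hx⟩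
  have hk' : ∀ x, klein j x ≠ k := fun x hx => hk ⟨x, hx⟩
  match i, j, hij with
  | true, false, _ => exact (inQuadrants_squareRep_mul_hexRep g hg' k hk').1
  | false, true, _ => exact (inQuadrants_squareRep_mul_hexRep k hk' g hg').2

theorem InQuadrants.klein_mul {m : Matrix (Fin 2) (Fin 2) ℤ} {i : Bool} (hm : InQuadrants i m)
    (x : Multiplicative (ZMod 2 × ZMod 2)) : InQuadrants i (hexRep (kleinHex x) * m) := by
  have h : hexRep (kleinHex x) ∈ [1, -1, !![0, 1; 1, 0], !![0, -1; -1, 0]] := by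
    revert x
    decide +kernel
  simp only [List.mem_cons, List.not_mem_nil, or_false] at h
  obtain ⟨h₁, h₂⟩ := hm
  cases i <;> simp only [InQuadrants, Bool.false_eq_true, if_false, if_true] at h₁ h₂ ⊢ <;>
    rcases h with h | h | h | h <;> rw [h] <;>
    simp [Matrix.mul_apply, Fin.sum_univ_two] <;> constructor <;> linarith

/-- A normal word is in the base group if empty; otherwise it is a single letter up to the base
group, or its matrix lies in the quadrants given by its first letter. -/
theorem normalWord_cases {d : PushoutI.NormalWord.Transversal klein}
    (w : PushoutI.NormalWord d) :
    (w.fstIdx = none ∧ w.prod = PushoutI.base klein w.head) ∨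
      ∃ i, w.fstIdx = some i ∧ (InQuadrants i (amalgamHom w.prod : GL (Fin 2) ℤ).val ∨
        ∃ g, g ∉ (klein i).range ∧ amalgamHom w.prod = repGL i g) := by
  classical
  induction w using PushoutI.NormalWord.consRecOn with
  | empty => exact Or.inl ⟨rfl, by simp⟩
  | cons i g w hmw _ hgr _ ih =>
    refine Or.inr ⟨i, by simp [PushoutI.NormalWord.cons], ?_⟩
    rw [PushoutI.NormalWord.prod_cons, map_mul, amalgamHom_of]
    rcases ih with ⟨-, hw⟩ | ⟨j, hj, hw | ⟨k, hk, hw⟩⟩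
    · refine Or.inr ⟨g * klein i w.head, ?_, ?_⟩
      · rwa [Subgroup.mul_mem_cancel_right _ (MonoidHom.mem_range.2 ⟨w.head, rfl⟩)]
      · rw [hw, amalgamHom_base i, map_mul]
    · exact Or.inl (hw.rep_mul (by rintro rfl; exact hmw hj) hgr)
    · rw [hw]
      exact Or.inl (inQuadrants_rep_mul_rep (by rintro rfl; exact hmw hj) hgr hk)
  | base h w _ ih =>
    have hp : (PushoutI.base klein h • w).prod = PushoutI.base klein h * w.prod :=
      PushoutI.NormalWord.prod_smul _ _
    rw [hp, map_mul]
    rcases ih with ⟨hw, hw'⟩ | ⟨i, hi, hw | ⟨g, hg, hw⟩⟩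
    · refine Or.inl ⟨hw, ?_⟩
      rw [hw', ← map_mul]
      rfl
    · refine Or.inr ⟨i, hi, Or.inl ?_⟩
      rw [amalgamHom_base false]
      exact hw.klein_mul h
    · refine Or.inr ⟨i, hi, Or.inr ⟨klein i h * g, ?_, ?_⟩⟩
      · rwa [Subgroup.mul_mem_cancel_left _ (MonoidHom.mem_range.2 ⟨h, rfl⟩)]
      · rw [hw, amalgamHom_base i, map_mul]

theorem amalgamHom_injective : Function.Injective amalgamHom := by
  classical
  obtain ⟨d⟩ := PushoutI.NormalWord.transversal_nonempty klein klein_injective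
  rw [injective_iff_map_eq_one]
  intro x hx
  obtain ⟨w, rfl⟩ := (PushoutI.NormalWord.equiv (d := d)).symm.surjective x
  change amalgamHom w.prod = 1 at hx
  change w.prod = 1
  rcases normalWord_cases w with ⟨-, hw⟩ | ⟨i, -, hw | ⟨g, hg, hw⟩⟩
  · rw [hw, amalgamHom_base true] at hx
    rw [map_eq_one_iff _ (repGL_injective true), map_eq_one_iff _ (klein_injective true)] at hx
    rw [hw, hx, map_one]
  · rw [hx] at hw
    exact absurd hw (not_inQuadrants_one i)
  · rw [hx, eq_comm, map_eq_one_iff _ (repGL_injective i)] at hw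
    exact absurd (hw ▸ one_mem _) hg

theorem range_sup_range_eq_top : (repGL true).range ⊔ (repGL false).range = ⊤ := by
  set K := (repGL true).range ⊔ (repGL false).range
  have hK : ∀ b g, repGL b g ∈ K := by
    rintro (_ | _) g
    · exact Subgroup.mem_sup_right ⟨g, rfl⟩
    · exact Subgroup.mem_sup_left ⟨g, rfl⟩
  have hS : SpecialLinearGroup.toGL ModularGroup.S ∈ K := by
    convert hK true (DihedralGroup.r 1 : DihedralGroup 4)
    apply Units.ext
    change !![0, -1; 1, 0] = squareRep (.r 1)
    decide +kernel
  have hT : SpecialLinearGroup.toGL ModularGroup.T ∈ K := by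
    convert mul_mem (hK true (DihedralGroup.r 3 : DihedralGroup 4))
      (hK false (DihedralGroup.r 1 : DihedralGroup 6))
    apply Units.ext
    change !![1, 1; 0, 1] = squareRep (.r 3) * hexRep (.r 1)
    decide +kernel
  have hSL (g : SpecialLinearGroup (Fin 2) ℤ) : SpecialLinearGroup.toGL g ∈ K := by
    have h : Subgroup.closure {ModularGroup.S, ModularGroup.T} ≤
        K.comap SpecialLinearGroup.toGL := by
      rw [Subgroup.closure_le]
      rintro _ (rfl | rfl)
      exacts [hS, hT]
    rw [SpecialLinearGroup.SL2Z_generators] at h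
    exact h (Subgroup.mem_top g)
  have hdet_one (g : GL (Fin 2) ℤ) (hg : g.val.det = 1) : g ∈ K := by
    convert hSL ⟨g.val, hg⟩
    exact Units.ext rfl
  rw [Subgroup.eq_top_iff']
  intro g
  rcases Int.isUnit_iff.1 ((Matrix.isUnit_iff_isUnit_det g.val).1 g.isUnit) with h | h
  · exact hdet_one g h
  · rw [← mul_mem_cancel_right (hK true (DihedralGroup.sr 0 : DihedralGroup 4))]
    apply hdet_one
    have hs : (squareRep (.sr 0)).det = -1 := by decide +kernel
    change (g.val * squareRep (.sr 0)).det = 1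
    rw [Matrix.det_mul, h, hs]
    norm_num

theorem amalgamHom_surjective : Function.Surjective amalgamHom := by
  rw [← MonoidHom.range_eq_top, eq_top_iff, ← range_sup_range_eq_top, sup_le_iff]
  constructor <;>
  · rintro _ ⟨g, rfl⟩
    exact ⟨_, amalgamHom_of _ g⟩

end DihedralAmalgam

/-- `GL₂(ℤ)` is generated by finite subgroups isomorphic to `D₈` and `D₁₂`, and is
isomorphic to the amalgamated free product `D₈ ∗_{C₂×C₂} D₁₂` over a Klein four group
embedded in both factors. -/
theorem stmt_9 :
    (∃ A B : Subgroup (GL (Fin 2) ℤ),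
      Nonempty (A ≃* DihedralGroup 4) ∧ Nonempty (B ≃* DihedralGroup 6) ∧ A ⊔ B = ⊤) ∧
    ∃ φ : ∀ b, Multiplicative (ZMod 2 × ZMod 2) →* Dfam b,
      (∀ b, Function.Injective (φ b)) ∧
      Nonempty ((GL (Fin 2) ℤ) ≃* Monoid.PushoutI φ) := by
  open DihedralAmalgam in
  refine ⟨⟨(repGL true).range, (repGL false).range,
    ⟨(MonoidHom.ofInjective (repGL_injective true)).symm⟩,
    ⟨(MonoidHom.ofInjective (repGL_injective false)).symm⟩, range_sup_range_eq_top⟩,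
    klein, klein_injective,
    ⟨(MulEquiv.ofBijective amalgamHom ⟨amalgamHom_injective, amalgamHom_surjective⟩).symm⟩⟩
end

section
/- Let G be a finite group and suppose the group algebra ℚG has no nonzero nilpotent elements. Then G is either abelian, or G is isomorphic to Q₈ × C₂ᵐ × A for some m ≥ 0 and some abelian group A of odd order (in particular every subgroup of G is normal). -/
/-- If `ℚG` is reduced, every cyclic subgroup of `G` is normal: `(1 - a) g⁻¹ (1 + a + ⋯ + aⁿ⁻¹)` has
square zero. -/
theorem conj_mem_zpowers {G : Type*} [Group G] [Finite G]
    (h : ∀ x : MonoidAlgebra ℚ G, IsNilpotent x → x = 0) (a g : G) :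
    g * a * g⁻¹ ∈ Subgroup.zpowers a := by
  classical
  set N : MonoidAlgebra ℚ G := ∑ i ∈ Finset.range (orderOf a), MonoidAlgebra.of ℚ G a ^ i with hN
  have hNa : N * (1 - MonoidAlgebra.of ℚ G a) = 0 := by
    have h1 := geom_sum_mul_neg (MonoidAlgebra.of ℚ G a) (orderOf a)
    rw [hN, h1, ← map_pow, pow_orderOf_eq_one, map_one, sub_self]
  set y : MonoidAlgebra ℚ G := (1 - MonoidAlgebra.of ℚ G a) * MonoidAlgebra.of ℚ G g⁻¹ * N with hy
  have hy0 : y = 0 := by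
    apply h
    refine ⟨2, ?_⟩
    have : y ^ 2 = (1 - MonoidAlgebra.of ℚ G a) * MonoidAlgebra.of ℚ G g⁻¹ *
        (N * (1 - MonoidAlgebra.of ℚ G a)) * MonoidAlgebra.of ℚ G g⁻¹ * N := by
      rw [hy]; noncomm_ring
    rw [this, hNa]; simp
  have h2 : ∑ i ∈ Finset.range (orderOf a), MonoidAlgebra.of ℚ G (g⁻¹ * a ^ i) =
      ∑ i ∈ Finset.range (orderOf a), MonoidAlgebra.of ℚ G (a * g⁻¹ * a ^ i) := by
    have : y = ∑ i ∈ Finset.range (orderOf a), MonoidAlgebra.of ℚ G (g⁻¹ * a ^ i) -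
      ∑ i ∈ Finset.range (orderOf a), MonoidAlgebra.of ℚ G (a * g⁻¹ * a ^ i) := by
      simp only [hy, hN, map_mul, map_pow, ← Finset.mul_sum]
      noncomm_ring
    rw [hy0] at this
    exact (sub_eq_zero.mp this.symm)
  have h3 := congrArg (fun f : MonoidAlgebra ℚ G => f.coeff (a * g⁻¹)) h2
  have hpos := orderOf_pos a
  by_contra hcon
  have h4 : ∀ i, g⁻¹ * a ^ i ≠ a * g⁻¹ := by
    intro i hi
    apply hcon
    refine ⟨i, ?_⟩
    rw [mul_assoc, ← hi]; simp
  have h6 : ∀ i ∈ Finset.range (orderOf a),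
      (0 : ℚ) ≤ (MonoidAlgebra.of ℚ G (a * g⁻¹ * a ^ i)).coeff (a * g⁻¹) := by
    intro i _
    rw [MonoidAlgebra.of_apply, MonoidAlgebra.coeff_single, Finsupp.single_apply]
    split_ifs <;> simp
  have h7 := Finset.single_le_sum h6 (Finset.mem_range.2 hpos)
  simp only [MonoidAlgebra.coeff_sum, Finsupp.finsetSum_apply] at h3
  rw [← h3, Finset.sum_eq_zero] at h7
  · simp only [MonoidAlgebra.of_apply, pow_zero, mul_one, MonoidAlgebra.coeff_single,
      Finsupp.single_eq_same] at h7
    exact absurd h7 (by norm_num)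
  · intro i _
    rw [MonoidAlgebra.of_apply, MonoidAlgebra.coeff_single, Finsupp.single_eq_of_ne (h4 i).symm]

theorem mul_pow_of_commutator {G : Type*} [Group G] {u v d : G} (h : v * u = u * v * d)
    (hu : Commute d u) (hv : Commute d v) (n : ℕ) :
    (u * v) ^ n = u ^ n * v ^ n * d ^ (n.choose 2) := by
  have h1 : ∀ n : ℕ, v ^ n * u = u * v ^ n * d ^ n := by
    intro n
    induction n with
    | zero => simp
    | succ n ih =>
      calc v ^ (n + 1) * u = v * (v ^ n * u) := by rw [pow_succ']; group
        _ = (v * u) * v ^ n * d ^ n := by rw [ih]; group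
        _ = u * v * (d * v ^ n) * d ^ n := by rw [h]; group
        _ = u * v * (v ^ n * d) * d ^ n := by rw [(hv.pow_right n).eq]
        _ = _ := by rw [pow_succ' v, pow_succ' d]; simp only [mul_assoc]
  induction n with
  | zero => simp
  | succ n ih =>
    have h2 : d ^ (n.choose 2) * (u * v) = u * v * d ^ (n.choose 2) :=
      ((hu.mul_right hv).pow_left _).eq
    calc (u * v) ^ (n + 1) = u ^ n * v ^ n * (d ^ (n.choose 2) * (u * v)) := by
          rw [pow_succ, ih]; group
      _ = u ^ n * (v ^ n * u) * v * d ^ (n.choose 2) := by rw [h2]; simp only [mul_assoc]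
      _ = u ^ (n + 1) * v ^ n * (d ^ n * v) * d ^ (n.choose 2) := by
          rw [h1, pow_succ u]; simp only [mul_assoc]
      _ = u ^ (n + 1) * v ^ (n + 1) * (d ^ n * d ^ (n.choose 2)) := by
          rw [(hv.pow_left n).eq, pow_succ v]; simp only [mul_assoc]
      _ = _ := by rw [← pow_add, Nat.choose_succ_succ' n 1, Nat.choose_one_right]

/-- A finite abelian group without elements of order `4` is `C₂ᵐ × A` with `A` of odd order. -/
theorem exists_mulEquiv_of_pow_four {K : Type*} [Group K] [Finite K]
    (hcomm : ∀ a b : K, a * b = b * a) (h4 : ∀ g : K, g ^ 4 = 1 → g ^ 2 = 1) :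
    ∃ (m : ℕ) (A : Type) (_ : CommGroup A) (_ : Finite A), Odd (Nat.card A) ∧
      Nonempty (K ≃* (Fin m → Multiplicative (ZMod 2)) × A) := by
  let _ : CommGroup K := { mul_comm := hcomm }
  obtain ⟨k, m, hm, hkm⟩ := Nat.exists_eq_two_pow_mul_odd (n := Nat.card K) Nat.card_pos.ne'
  have hpow : ∀ (j : ℕ) (g : K), g ^ 2 ^ j = 1 → g ^ 2 = 1 := by
    intro j
    induction j with
    | zero => intro g hg; simp at hg; simp [hg]
    | succ j ih =>
      intro g hg
      apply h4
      have := ih (g ^ 2) (by rw [← pow_mul, ← pow_succ', hg])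
      rw [← pow_mul] at this
      exact this
  have h2m : ∀ g : K, (g ^ m) ^ 2 = 1 := fun g => hpow k _ (by
    rw [← pow_mul, mul_comm, ← hkm, pow_card_eq_one'])
  obtain ⟨r, hr⟩ := hm
  let T : Subgroup K := (powMonoidHom 2 : K →* K).ker
  let A : Subgroup K := (powMonoidHom m : K →* K).ker
  have hT : ∀ g, g ∈ T ↔ g ^ 2 = 1 := fun g => Iff.rfl
  have hA : ∀ g, g ∈ A ↔ g ^ m = 1 := fun g => Iff.rfl
  have hTA : ∀ g : K, g ^ 2 = 1 → g ^ m = 1 → g = 1 := by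
    intro g h2 hm
    simpa [hr, pow_succ, pow_mul, h2] using hm
  have hAodd : Odd (Nat.card A) := by
    rw [← Nat.not_even_iff_odd, even_iff_two_dvd]
    intro hd
    obtain ⟨g, hg⟩ := exists_prime_orderOf_dvd_card' (G := A) 2 hd
    have h1 : (g : K) = 1 := hTA _ (by
      rw [← Subgroup.coe_pow, ← hg, pow_orderOf_eq_one]; rfl) ((hA _).1 g.2)
    have : g = 1 := Subtype.ext h1
    simp [this] at hg
  have hbij : Function.Bijective (MonoidHom.coprod T.subtype A.subtype) := by
    constructor
    · rw [injective_iff_map_eq_one]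
      rintro ⟨⟨t, ht⟩, ⟨a, ha⟩⟩ h
      simp only [MonoidHom.coprod_apply, Subgroup.subtype_apply] at h
      have hat : a = t⁻¹ := eq_inv_of_mul_eq_one_right h
      rw [hT] at ht
      rw [hA] at ha
      have : a = 1 := hTA a (by simp [hat, ht]) ha
      have ht1 : t = 1 := by simpa [this] using h
      subst this; subst ht1; rfl
    · intro g
      refine ⟨⟨⟨g ^ m, h2m g⟩, ⟨(g ^ (2 * r))⁻¹, ?_⟩⟩, ?_⟩
      · have h1 : g ^ (2 * r * m) = ((g ^ m) ^ 2) ^ r := by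
          rw [← pow_mul, ← pow_mul]; congr 1; ring
        rw [hA, inv_pow, ← pow_mul, inv_eq_one, h1, h2m, one_pow]
      · simp [hr, pow_succ]
  let eTA : T × A ≃* K := MulEquiv.ofBijective _ hbij
  let _ : Module (ZMod 2) (Additive T) := AddCommGroup.zmodModule (by
    intro t
    exact Subtype.ext t.toMul.2)
  let b := Module.finBasis (ZMod 2) (Additive T)
  let e1 : Additive T ≃+ (Fin (Module.finrank (ZMod 2) (Additive T)) → ZMod 2) :=
    b.equivFun.toAddEquiv
  let e2 : T ≃* (Fin (Module.finrank (ZMod 2) (Additive T)) → Multiplicative (ZMod 2)) :=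
    { toFun t := fun i => Multiplicative.ofAdd (e1 (Additive.ofMul t) i)
      invFun f := (e1.symm fun i => (f i).toAdd).toMul
      left_inv t := by simp
      right_inv f := by simp
      map_mul' s t := by ext i; simp }
  have e3 : A ≃* Shrink.{0} A := (Shrink.mulEquiv).symm
  refine ⟨_, Shrink.{0} A, inferInstance, inferInstance, ?_, ⟨eTA.symm.trans (e2.prodCongr e3)⟩⟩
  rwa [← Nat.card_congr e3.toEquiv]

theorem zpow_mul_zpow_of_commutator {G : Type*} [Group G] {x y c : G} (h : y * x = x * y * c)
    (hx : Commute c x) (hy : Commute c y) (i j : ℤ) :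
    y ^ j * x ^ i = x ^ i * y ^ j * c ^ (i * j) := by
  have h1 : MulAut.conj y x = x * c := by
    rw [MulAut.conj_apply, h, mul_assoc x, ← hy.eq]; group
  have h2 : MulAut.conj y (x ^ i) = x ^ i * c ^ i := by
    rw [map_zpow, h1, hx.symm.mul_zpow]
  have h3 : MulAut.conj (x ^ i)⁻¹ y = y * c ^ i := by
    rw [MulAut.conj_apply] at h2 ⊢
    have h4 : y * x ^ i = x ^ i * c ^ i * y := by rw [← h2]; group
    rw [inv_inv, mul_assoc, h4, mul_assoc, (hy.zpow_left i).eq]; group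
  have h5 : MulAut.conj (x ^ i)⁻¹ (y ^ j) = y ^ j * c ^ (i * j) := by
    rw [map_zpow, h3, (hy.symm.zpow_right i).mul_zpow, zpow_mul]
  rw [mul_assoc, ← h5, MulAut.conj_apply]; group

theorem exists_zpow_mul_prime_pow_eq {G : Type*} [Group G] {p a : ℕ} (hp : p.Prime) {x c : G}
    (hx : orderOf x = p ^ (a + 1)) (hc : c ∈ Subgroup.zpowers x) (hc1 : c ≠ 1)
    (hcp : c ^ p = 1) : ∃ s : ℤ, ¬ (p : ℤ) ∣ s ∧ x ^ (s * (p : ℤ) ^ a) = c := by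
  obtain ⟨n, rfl⟩ := hc
  simp only at hc1 hcp ⊢
  have hp0 : (p : ℤ) ≠ 0 := by exact_mod_cast hp.ne_zero
  rw [← zpow_natCast, ← zpow_mul, ← orderOf_dvd_iff_zpow_eq_one, hx, Nat.cast_pow, pow_succ] at hcp
  obtain ⟨s, rfl⟩ := Int.dvd_of_mul_dvd_mul_right hp0 hcp
  refine ⟨s, ?_, by rw [mul_comm]⟩
  rintro ⟨t, rfl⟩
  apply hc1
  rw [← orderOf_dvd_iff_zpow_eq_one, hx, Nat.cast_pow, pow_succ, ← mul_assoc]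
  exact dvd_mul_right _ _

theorem Commute.of_zpow_right {G : Type*} [Group G] {x y : G} {p n : ℕ} (hp : p.Prime) {t : ℤ}
    (ht : ¬ (p : ℤ) ∣ t) (hy : y ^ p ^ n = 1) (h : Commute x (y ^ t)) : Commute x y := by
  have hcop : IsCoprime t ((p : ℤ) ^ n) := by
    refine IsCoprime.pow_right ?_
    exact ((Nat.prime_iff_prime_int.1 hp).coprime_iff_not_dvd.2 ht).symm
  obtain ⟨u, v, huv⟩ := hcop
  have : y = (y ^ t) ^ u := by
    have hy' : y ^ ((p : ℤ) ^ n) = 1 := by exact_mod_cast hy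
    rw [← zpow_mul]
    conv_lhs => rw [← zpow_one y, ← huv, zpow_add, mul_comm v, zpow_mul y _ v, hy', one_zpow, mul_one,
      mul_comm u]
  rw [this]
  exact h.zpow_right u

/-- In a finite group with all cyclic subgroups normal, a noncommuting pair with minimal sum of orders
generates a quaternion group. -/
theorem exists_quaternion_pair_of_minimal {G : Type*} [Group G] [Finite G]
    (hn : ∀ a g : G, g * a * g⁻¹ ∈ Subgroup.zpowers a) {x y : G} (hxy : ¬ Commute x y)
    (hmin : ∀ x' y' : G, ¬ Commute x' y' → orderOf x + orderOf y ≤ orderOf x' + orderOf y')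
    (hle : orderOf y ≤ orderOf x) :
    orderOf x = 4 ∧ y ^ 2 = x ^ 2 ∧ y * x * y⁻¹ = x⁻¹ := by
  obtain ⟨c, hc⟩ : ∃ c, c = y⁻¹ * x⁻¹ * y * x := ⟨_, rfl⟩
  have hcomm : y * x = x * y * c := by rw [hc]; group
  have hc1 : c ≠ 1 := by
    rintro rfl
    exact hxy (by rw [mul_one] at hcomm; exact hcomm.symm)
  have hcx : c ∈ Subgroup.zpowers x := by
    rw [hc]
    refine mul_mem ?_ (Subgroup.mem_zpowers x)
    simpa [mul_assoc] using inv_mem (hn x y⁻¹)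
  have hcy : c ∈ Subgroup.zpowers y := by
    rw [hc, mul_assoc, mul_assoc]
    refine mul_mem (inv_mem (Subgroup.mem_zpowers y)) ?_
    simpa [mul_assoc] using (hn y x⁻¹)
  have hCx : Commute c x := by
    obtain ⟨n, rfl⟩ := hcx
    exact (Commute.refl x).zpow_left n
  have hCy : Commute c y := by
    obtain ⟨n, rfl⟩ := hcy
    exact (Commute.refl y).zpow_left n
  have hz := zpow_mul_zpow_of_commutator hcomm hCx hCy
  have hcpx : ∀ p : ℕ, p.Prime → p ∣ orderOf x → c ^ p = 1 := by
    intro p hp hd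
    have h1 : Commute (x ^ p) y := by
      by_contra hcon
      have := hmin _ _ hcon
      have h2 : orderOf (x ^ p) = orderOf x / p := orderOf_pow_of_dvd hp.ne_zero hd
      have := Nat.div_lt_self (orderOf_pos x) hp.one_lt
      omega
    have h2 := hz p 1
    simp only [zpow_one, mul_one, zpow_natCast] at h2
    rw [← h1.eq.symm] at h2
    simpa using h2
  have hcpy : ∀ p : ℕ, p.Prime → p ∣ orderOf y → c ^ p = 1 := by
    intro p hp hd
    have h1 : Commute x (y ^ p) := by
      by_contra hcon
      have := hmin _ _ hcon
      have h2 : orderOf (y ^ p) = orderOf y / p := orderOf_pow_of_dvd hp.ne_zero hd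
      have := Nat.div_lt_self (orderOf_pos y) hp.one_lt
      omega
    have h2 := hz 1 p
    simp only [zpow_one, one_mul, zpow_natCast] at h2
    rw [← h1.eq] at h2
    simpa using h2
  have hx1 : orderOf x ≠ 1 := by
    rw [Ne, orderOf_eq_one_iff]; rintro rfl; exact hxy (Commute.one_left y)
  have hy1 : orderOf y ≠ 1 := by
    rw [Ne, orderOf_eq_one_iff]; rintro rfl; exact hxy (Commute.one_right x)
  obtain ⟨p, hp, hpx⟩ := Nat.exists_prime_and_dvd hx1
  have hcp := hcpx p hp hpx
  have hoc : orderOf c = p := by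
    have := Fact.mk hp
    exact orderOf_eq_prime hcp hc1
  have huniq : ∀ q : ℕ, q.Prime → c ^ q = 1 → q = p := by
    intro q hq h
    have := orderOf_dvd_of_pow_eq_one h
    rw [hoc] at this
    exact ((Nat.prime_dvd_prime_iff_eq hp hq).1 this).symm
  have hox := Nat.eq_prime_pow_of_unique_prime_dvd (orderOf_pos x).ne'
    (fun {d} hd hdx => huniq d hd (hcpx d hd hdx))
  have hoy := Nat.eq_prime_pow_of_unique_prime_dvd (orderOf_pos y).ne'
    (fun {d} hd hdx => huniq d hd (hcpy d hd hdx))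
  generalize (orderOf x).primeFactorsList.length = a at hox
  generalize (orderOf y).primeFactorsList.length = b at hoy
  obtain _ | a := a
  · simp at hox; exact absurd hox (by simpa using hx1)
  obtain _ | b := b
  · simp at hoy; exact absurd hoy (by simpa using hy1)
  obtain ⟨e, rfl⟩ : ∃ e, a = b + e := by
    rw [hox, hoy, Nat.pow_le_pow_iff_right hp.one_lt] at hle
    exact Nat.exists_eq_add_of_le (by omega)
  obtain ⟨s, hs, hxs⟩ := exists_zpow_mul_prime_pow_eq hp hox hcx hc1 hcp
  obtain ⟨t, ht, hyt⟩ := exists_zpow_mul_prime_pow_eq hp hoy hcy hc1 hcp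
  have hxz : ¬ Commute x (x ^ (-(s * (p : ℤ) ^ e)) * y ^ t) := by
    intro h
    refine hxy (Commute.of_zpow_right hp ht (n := b + 1) (by rw [← hoy, pow_orderOf_eq_one]) ?_)
    have h1 := ((Commute.refl x).zpow_right (s * (p : ℤ) ^ e)).mul_right h
    rwa [← mul_assoc, ← zpow_add, add_neg_cancel, zpow_zero, one_mul] at h1
  have hzb := mul_pow_of_commutator (hz (-(s * (p : ℤ) ^ e)) t) ((hCx.zpow_right _).zpow_left _)
    ((hCy.zpow_right _).zpow_left _) (p ^ b)
  have hu : (x ^ (-(s * (p : ℤ) ^ e))) ^ p ^ b = c⁻¹ := by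
    rw [← zpow_natCast, ← zpow_mul, ← hxs, ← zpow_neg]
    congr 1
    push_cast
    ring
  have hv : (y ^ t) ^ p ^ b = c := by
    rw [← zpow_natCast, ← zpow_mul, ← hyt, Nat.cast_pow]
  rw [hu, hv, inv_mul_cancel, one_mul, ← zpow_natCast _ (Nat.choose _ _), ← zpow_mul] at hzb
  have hne : (x ^ (-(s * (p : ℤ) ^ e)) * y ^ t) ^ p ^ b ≠ 1 := by
    intro h
    have h1 := orderOf_le_of_pow_eq_one (pow_pos hp.pos b) h
    have h2 := hmin _ _ hxz
    have h3 : p ^ b < p ^ (b + 1) := Nat.pow_lt_pow_right hp.one_lt (by omega)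
    omega
  rw [hzb, Ne, ← orderOf_dvd_iff_zpow_eq_one, hoc] at hne
  have he : e = 0 := by
    by_contra he
    refine hne (Dvd.dvd.mul_right (Dvd.dvd.mul_right ?_ _) _)
    rw [dvd_neg]
    exact Dvd.dvd.mul_left (dvd_pow_self _ he) _
  have hch : p ^ b = 2 := by
    by_contra hcon
    refine hne (Dvd.dvd.mul_left ?_ _)
    exact_mod_cast hp.dvd_choose_pow two_ne_zero (Ne.symm hcon)
  have hb : b = 1 := Nat.Prime.eq_one_of_pow (hch ▸ Nat.prime_two)
  subst hb he
  obtain rfl : p = 2 := by simpa using hch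
  have hsq : ∀ w : G, orderOf w = 2 ^ 2 → ∀ r : ℤ, ¬ ((2 : ℕ) : ℤ) ∣ r →
      w ^ (r * ((2 : ℕ) : ℤ) ^ 1) = c → c = w ^ 2 := by
    intro w hw r hr hwr
    obtain ⟨k, rfl⟩ : Odd r := Int.not_even_iff_odd.1 (by rwa [even_iff_two_dvd])
    have h4 : w ^ 4 = 1 := by rw [← orderOf_dvd_iff_pow_eq_one, hw]; norm_num
    calc c = (w ^ 4) ^ k * w ^ 2 := by rw [← hwr]; group
      _ = w ^ 2 := by rw [h4, one_zpow, one_mul]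
  have h1 := hsq x hox s hs hxs
  have h2 := hsq y hoy t ht hyt
  refine ⟨hox, by rw [← h1, ← h2], ?_⟩
  rw [hcomm, mul_assoc x, ← hCy.eq, h1]
  have h4 : x ^ 4 = 1 := by rw [← orderOf_dvd_iff_pow_eq_one, hox]; norm_num
  rw [eq_inv_iff_mul_eq_one, ← h4]; group

theorem exists_quaternion_pair {G : Type*} [Group G] [Finite G]
    (hn : ∀ a g : G, g * a * g⁻¹ ∈ Subgroup.zpowers a) (hG : ¬ ∀ a b : G, a * b = b * a) :
    ∃ x y : G, orderOf x = 4 ∧ y ^ 2 = x ^ 2 ∧ y * x * y⁻¹ = x⁻¹ := by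
  push Not at hG
  obtain ⟨a, b, hab⟩ := hG
  obtain ⟨⟨x, y⟩, hxy, hmin⟩ := exists_minimalFor_of_wellFoundedLT
    (fun q : G × G => ¬ Commute q.1 q.2) (fun q => orderOf q.1 + orderOf q.2) ⟨(a, b), hab⟩
  replace hmin : ∀ x' y' : G, ¬ Commute x' y' → orderOf x + orderOf y ≤ orderOf x' + orderOf y' := by
    intro x' y' h
    by_contra! hlt
    exact hlt.not_ge (hmin (j := (x', y')) h hlt.le)
  rcases le_total (orderOf y) (orderOf x) with hle | hle
  · exact ⟨x, y, exists_quaternion_pair_of_minimal hn hxy hmin hle⟩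
  · refine ⟨y, x, exists_quaternion_pair_of_minimal hn (fun h => hxy h.symm) (fun x' y' h => ?_) hle⟩
    rw [add_comm]
    exact hmin x' y' h

/-- The homomorphism from `Q₈` given by two elements satisfying its defining relations. -/
def quaternionHom {G : Type*} [Group G] (x y : G) (hx : x ^ 4 = 1) (hy : y ^ 2 = x ^ 2)
    (hconj : y * x * y⁻¹ = x⁻¹) : QuaternionGroup 2 →* G :=
  have hadd : ∀ i j : ZMod (2 * 2), x ^ (i + j).val = x ^ i.val * x ^ j.val := fun i j => by
    rw [ZMod.val_add, ← pow_add, ← pow_eq_pow_mod _ hx]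
  have hsub : ∀ i j : ZMod (2 * 2), x ^ (j - i).val = (x ^ i.val)⁻¹ * x ^ j.val := fun i j => by
    rw [eq_inv_mul_iff_mul_eq, ← hadd, add_sub_cancel]
  have hswap : ∀ n : ℕ, x ^ n * y = y * (x ^ n)⁻¹ := fun n => by
    have h1 : y * x ^ n * y⁻¹ = (x ^ n)⁻¹ := by rw [← conj_pow, hconj, inv_pow]
    rw [eq_mul_inv_iff_mul_eq, mul_assoc, ← eq_inv_mul_iff_mul_eq, ← h1]
    group
  { toFun
      | .a i => x ^ i.val
      | .xa i => y * x ^ i.val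
    map_one' := by rw [QuaternionGroup.one_def]; simp
    map_mul' := by
      rintro (i | i) (j | j)
      · simp only [QuaternionGroup.a_mul_a, hadd]
      · simp only [QuaternionGroup.a_mul_xa, hsub]
        rw [← mul_assoc, ← mul_assoc, hswap]
      · simp only [QuaternionGroup.xa_mul_a, hadd, mul_assoc]
      · simp only [QuaternionGroup.xa_mul_xa]
        have h2 : x ^ ((2 : ℕ) : ZMod (2 * 2)).val = x ^ 2 := rfl
        calc x ^ (((2 : ℕ) : ZMod (2 * 2)) + j - i).val
            = (x ^ i.val)⁻¹ * (x ^ 2 * x ^ j.val) := by rw [hsub, hadd, h2]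
          _ = x ^ 2 * (x ^ i.val)⁻¹ * x ^ j.val := by group
          _ = y * (x ^ i.val * y) * x ^ j.val := by rw [hswap, ← hy, sq, mul_assoc y y]
          _ = y * x ^ i.val * (y * x ^ j.val) := by simp only [mul_assoc] }

theorem exists_index_two_not_mem {C : Type*} [Group C] [Finite C]
    (hcomm : ∀ a b : C, a * b = b * a) (h4 : ∀ g : C, g ^ 4 = 1 → g ^ 2 = 1)
    {c : C} (hc : c ^ 2 = 1) (hc1 : c ≠ 1) :
    ∃ K : Subgroup C, c ∉ K ∧ ∀ g, g ∈ K ∨ c * g ∈ K := by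
  obtain ⟨m, A, _, _, hA, ⟨e⟩⟩ := exists_mulEquiv_of_pow_four hcomm h4
  have h2 : (e c).2 = 1 := by
    have h1 : (e c).2 ^ 2 = 1 := by rw [← Prod.pow_snd, ← map_pow, hc, map_one, Prod.snd_one]
    obtain ⟨r, hr⟩ := hA
    have h3 : (e c).2 ^ (2 * r + 1) = 1 := by rw [← hr, pow_card_eq_one']
    simpa [pow_succ, pow_mul, h1] using h3
  have h3 : (e c).1 ≠ 1 := fun h =>
    hc1 (e.injective (by rw [map_one]; exact Prod.ext h h2))
  obtain ⟨i, hi⟩ := Function.ne_iff.1 h3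
  have hZ : ∀ u v : Multiplicative (ZMod 2), u ≠ 1 → v = 1 ∨ u * v = 1 := by decide
  refine ⟨((Pi.evalMonoidHom (fun _ : Fin m => Multiplicative (ZMod 2)) i).comp
    ((MonoidHom.fst _ A).comp e.toMonoidHom)).ker, hi, fun g => ?_⟩
  simp only [MonoidHom.mem_ker, map_mul]
  exact hZ _ _ hi

theorem conj_eq_or_of_pow_four {G : Type*} [Group G] {a g : G} (ha : a ^ 4 = 1)
    (h : g * a * g⁻¹ ∈ Subgroup.zpowers a) : g * a * g⁻¹ = a ∨ g * a * g⁻¹ = a⁻¹ := by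
  obtain ⟨n, hn⟩ := h
  simp only at hn
  have hk : ∀ k : ℤ, a ^ (4 * k) = 1 := fun k => by
    rw [zpow_mul]; norm_cast; rw [ha, one_zpow]
  have h1 : g * a * g⁻¹ = 1 → g * a * g⁻¹ = a := fun h => by
    rw [h]; exact (conj_eq_one_iff.1 h).symm
  obtain ⟨k, rfl | rfl | rfl | rfl⟩ :
      ∃ k, n = 4 * k ∨ n = 4 * k + 1 ∨ n = 4 * k + 2 ∨ n = 4 * k + 3 := ⟨n / 4, by omega⟩
  · exact Or.inl (h1 (by rw [← hn, hk]))
  · left; rw [← hn, zpow_add, hk]; simp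
  · left
    have h2 : g * a * g⁻¹ = a ^ 2 := by rw [← hn, zpow_add, hk, one_mul]; norm_cast
    have h3 : a ^ 2 = 1 := (conj_eq_one_iff (a := g)).1 (by rw [← conj_pow, h2, ← pow_mul, ha])
    exact h1 (h2.trans h3)
  · right
    rw [← hn, zpow_add, hk, one_mul, eq_inv_iff_mul_eq_one, ← ha]; group

/-- Dedekind's classification of finite Hamiltonian groups. -/
theorem exists_mulEquiv_of_conj_mem_zpowers {G : Type*} [Group G] [Finite G]
    (hn : ∀ a g : G, g * a * g⁻¹ ∈ Subgroup.zpowers a) (hG : ¬ ∀ a b : G, a * b = b * a) :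
    ∃ (m : ℕ) (A : Type) (_ : CommGroup A) (_ : Finite A),
      Odd (Nat.card A) ∧
      Nonempty (G ≃* QuaternionGroup 2 × (Fin m → Multiplicative (ZMod 2)) × A) := by
  obtain ⟨x, y, hx, hy, hyx⟩ := exists_quaternion_pair hn hG
  have hx4 : x ^ 4 = 1 := hx ▸ pow_orderOf_eq_one x
  have hx2 : x ^ 2 ≠ 1 := pow_ne_one_of_lt_orderOf two_ne_zero (by omega)
  have hy4 : y ^ 4 = 1 := by rw [pow_mul y 2 2, hy, ← pow_mul, hx4]
  have hxinv : x⁻¹ ≠ x := fun h => hx2 (by rw [sq]; nth_rw 1 [← h]; simp)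
  have hyxs : x * y = y * x⁻¹ := by
    rw [eq_mul_inv_iff_mul_eq, mul_assoc, ← eq_inv_mul_iff_mul_eq, ← hyx]; group
  have hxy : x * y * x⁻¹ = y⁻¹ := by
    calc x * y * x⁻¹ = y * (x ^ 2)⁻¹ := by rw [hyxs]; group
      _ = y⁻¹ := by rw [← hy]; group
  have hnxy : ¬ Commute x y := fun h => hxinv (by rw [← hyx, ← h.eq]; group)
  let C : Subgroup G := Subgroup.centralizer {x, y}
  have hC : ∀ g, g ∈ C ↔ Commute g x ∧ Commute g y := by
    intro g
    simp only [C, Subgroup.mem_centralizer_iff, Set.mem_insert_iff, Set.mem_singleton_iff,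
      forall_eq_or_imp, forall_eq]
    exact and_congr eq_comm eq_comm
  have hC4 : ∀ g : G, g ∈ C → g ^ 4 = 1 → g ^ 2 = 1 := by
    intro g hg hg4
    obtain ⟨hgx, hgy⟩ := (hC g).1 hg
    have h1 : y * (g * x) * y⁻¹ = g * x⁻¹ := by
      rw [← hyx, ← mul_assoc, ← hgy.eq]; group
    have h2 := conj_eq_or_of_pow_four (by rw [hgx.mul_pow, hg4, hx4, one_mul]) (hn (g * x) y)
    rw [h1, hgx.eq, mul_inv_rev, mul_left_inj, ← hgx.eq, mul_right_inj] at h2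
    obtain h2 | h2 := h2
    · exact absurd h2 hxinv
    · rw [sq]; nth_rw 1 [h2]; simp
  have hK4 : ∀ g : C, g ^ 4 = 1 → g ^ 2 = 1 := fun g hg =>
    Subtype.ext (hC4 g g.2 (congrArg Subtype.val hg))
  have hCcomm : ∀ a b : C, a * b = b * a := by
    by_contra hcon
    have hnC : ∀ a g : C, g * a * g⁻¹ ∈ Subgroup.zpowers a := by
      intro a g
      obtain ⟨n, hn⟩ := hn (a : G) g
      exact ⟨n, Subtype.ext (by simpa using hn)⟩
    obtain ⟨u, -, hu, -⟩ := exists_quaternion_pair hnC hcon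
    exact pow_ne_one_of_lt_orderOf two_ne_zero (by omega) (hK4 u (hu ▸ pow_orderOf_eq_one u))
  have hcC : x ^ 2 ∈ C := (hC _).2 ⟨(Commute.refl x).pow_left 2, hy ▸ (Commute.refl y).pow_left 2⟩
  obtain ⟨K, hcK, hK⟩ := exists_index_two_not_mem hCcomm hK4 (c := ⟨x ^ 2, hcC⟩)
    (Subtype.ext (by simpa [← pow_mul] using hx4)) (fun h => hx2 (congrArg Subtype.val h))
  obtain ⟨m, A, iA, fA, hA, ⟨e⟩⟩ := exists_mulEquiv_of_pow_four (K := K)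
    (fun a b => Subtype.ext (hCcomm a b)) (fun g hg => Subtype.ext (hK4 g (congrArg Subtype.val hg)))
  let Q := quaternionHom x y hx4 hy hyx
  have hQa : ∀ i, Q (.a i) = x ^ i.val := fun _ => rfl
  have hQxa : ∀ i, Q (.xa i) = y * x ^ i.val := fun _ => rfl
  have hcomm : ∀ (q : QuaternionGroup 2) (k : K), Commute (Q q) (C.subtype.comp K.subtype k) := by
    intro q k
    obtain ⟨h1, h2⟩ := (hC _).1 k.1.2
    rcases q with i | i
    · exact (h1.pow_right _).symm
    · exact (h2.mul_right (h1.pow_right _)).symm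
  have hQK : ∀ q (k : K), Q q = (k : C) → q = 1 := by
    intro q k hq
    obtain ⟨h1, h2⟩ := (hC _).1 k.1.2
    rw [← hq] at h1 h2
    rcases q with i | i
    · rw [hQa] at hq h2
      fin_cases i
      · rfl
      · exact absurd (by simpa using (show Commute (x ^ 1) y from h2)) hnxy
      · refine absurd ?_ hcK
        have : (k : C) = ⟨x ^ 2, hcC⟩ := Subtype.ext hq.symm
        exact this ▸ k.2
      · have h3 : x ^ 3 = x⁻¹ := by rw [eq_inv_iff_mul_eq_one, ← pow_succ, hx4]
        have h4 : Commute (x ^ 3) y := h2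
        rw [h3] at h4
        exact absurd (Commute.inv_left_iff.1 h4) hnxy
    · rw [hQxa] at h1
      have h3 := h1.mul_left ((Commute.refl x).pow_left i.val).inv_left
      rw [mul_inv_cancel_right] at h3
      exact absurd h3.symm hnxy
  have hbij : Function.Bijective (MonoidHom.noncommCoprod Q (C.subtype.comp K.subtype) hcomm) := by
    constructor
    · rw [injective_iff_map_eq_one]
      rintro ⟨q, k⟩ h
      rw [MonoidHom.noncommCoprod_apply] at h
      have hq : q = 1 := hQK q k⁻¹ (by simpa using eq_inv_of_mul_eq_one_left h)
      subst hq
      simp only [map_one, one_mul] at h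
      have hk : k = 1 := Subtype.ext (Subtype.ext (by simpa using h))
      rw [hk]; rfl
    · rw [← MonoidHom.range_eq_top, eq_top_iff]
      have hKr : ∀ k : C, k ∈ K →
          (k : G) ∈ (MonoidHom.noncommCoprod Q (C.subtype.comp K.subtype) hcomm).range :=
        fun k hk => ⟨(1, ⟨k, hk⟩), by simp⟩
      have hQr : ∀ q, Q q ∈ (MonoidHom.noncommCoprod Q (C.subtype.comp K.subtype) hcomm).range :=
        fun q => ⟨(q, 1), by simp⟩
      generalize (MonoidHom.noncommCoprod Q (C.subtype.comp K.subtype) hcomm).range = R at hKr hQr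
      have hxR : x ∈ R := by simpa using (show x ^ 1 ∈ R from hQr (.a 1))
      have hyR : y ∈ R := by simpa [hQxa] using hQr (.xa 0)
      have hCR : ∀ g, g ∈ C → g ∈ R := by
        intro g hg
        obtain h | h := hK ⟨g, hg⟩
        · exact hKr _ h
        · exact (R.mul_mem_cancel_left (R.pow_mem hxR 2)).1 (hKr _ h)
      have hconj : ∀ g, g * x * g⁻¹ = x → g * y * g⁻¹ = y → g ∈ R := fun g h1 h2 =>
        hCR g ((hC g).2 ⟨mul_inv_eq_iff_eq_mul.1 h1, mul_inv_eq_iff_eq_mul.1 h2⟩)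
      have hassoc : ∀ w g a : G, w * g * a * (w * g)⁻¹ = w * (g * a * g⁻¹) * w⁻¹ :=
        fun w g a => by group
      have hyx' : y * x⁻¹ * y⁻¹ = x := by rw [← conj_inv, hyx, inv_inv]
      have hxy' : x * y⁻¹ * x⁻¹ = y := by rw [← conj_inv, hxy, inv_inv]
      rintro g -
      obtain h1 | h1 := conj_eq_or_of_pow_four hx4 (hn x g) <;>
      obtain h2 | h2 := conj_eq_or_of_pow_four hy4 (hn y g)
      · exact hconj g h1 h2
      · refine (R.mul_mem_cancel_left hxR).1 (hconj (x * g) ?_ ?_)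
        · rw [hassoc, h1, mul_inv_cancel_right]
        · rw [hassoc, h2, hxy']
      · refine (R.mul_mem_cancel_left hyR).1 (hconj (y * g) ?_ ?_)
        · rw [hassoc, h1, hyx']
        · rw [hassoc, h2, mul_inv_cancel_right]
      · refine (R.mul_mem_cancel_left (R.mul_mem hxR hyR)).1 (hconj (x * y * g) ?_ ?_)
        · rw [hassoc, h1, hassoc, hyx', mul_inv_cancel_right]
        · rw [hassoc, h2, hassoc, mul_inv_cancel, one_mul, hxy']
  exact ⟨m, A, iA, fA, hA,
    ⟨(MulEquiv.ofBijective _ hbij).symm.trans ((MulEquiv.refl _).prodCongr e)⟩⟩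

/-- If the rational group algebra `ℚG` of a finite group `G` has no nonzero nilpotent
elements, then `G` is abelian or `G ≅ Q₈ × C₂ᵐ × A` with `A` abelian of odd order. -/
theorem stmt_13 (G : Type*) [Group G] [Finite G]
    (h : ∀ x : MonoidAlgebra ℚ G, IsNilpotent x → x = 0) :
    (∀ a b : G, a * b = b * a) ∨
      ∃ (m : ℕ) (A : Type) (_ : CommGroup A) (_ : Finite A),
        Odd (Nat.card A) ∧
        Nonempty (G ≃* QuaternionGroup 2 × (Fin m → Multiplicative (ZMod 2)) × A) := by
  by_cases hG : ∀ a b : G, a * b = b * a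
  · exact Or.inl hG
  · exact Or.inr (exists_mulEquiv_of_conj_mem_zpowers (conj_mem_zpowers h) hG)
end

section
/- The rational group algebra of the dicyclic group Dic₃ of order 12 decomposes as ℚ[Dic₃] ≅ ℚ × ℚ × ℚ(i) × (−1,−3/ℚ) × M₂(ℚ), where (−1,−3/ℚ) is the quaternion algebra over ℚ with i² = −1, j² = −3, ij = −ji. -/
open scoped Quaternion

namespace QuaternionGroup

/-- The monoid homomorphism out of the dicyclic group of order `4n` determined by images `u` of
`a 1` and `v` of `xa 0` satisfying the defining relations. -/
def liftHom {n : ℕ} [NeZero n] {A : Type*} [Monoid A] (u v : A) (hu : u ^ (2 * n) = 1)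
    (hv : v * v = u ^ n) (huv : u * v * u = v) : QuaternionGroup n →* A where
  toFun
    | a i => u ^ i.val
    | xa i => v * u ^ i.val
  map_one' := by
    change u ^ (0 : ZMod (2 * n)).val = 1
    simp
  map_mul' := by
    have hadd (i j : ZMod (2 * n)) : u ^ (i + j).val = u ^ i.val * u ^ j.val := by
      rw [ZMod.val_add, ← pow_eq_pow_mod _ hu, pow_add]
    have hconj (k : ℕ) : u ^ k * v * u ^ k = v := by
      induction k with
      | zero => simp
      | succ k ih =>
        calc u ^ (k + 1) * v * u ^ (k + 1) = u ^ k * (u * v * u) * u ^ k := by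
              nth_rw 1 [pow_succ]
              rw [pow_succ']
              simp only [mul_assoc]
          _ = v := by rw [huv, ih]
    have hswap (i j : ZMod (2 * n)) : u ^ i.val * (v * u ^ j.val) = v * u ^ (j - i).val := by
      nth_rw 1 [← add_sub_cancel i j]
      rw [hadd, ← mul_assoc, ← mul_assoc, hconj]
    have hn : u ^ (n : ZMod (2 * n)).val = v * v := by
      rw [ZMod.val_natCast, ← pow_eq_pow_mod _ hu, hv]
    rintro (i | i) (j | j)
    · exact hadd i j
    · exact (hswap i j).symm
    · change v * u ^ (i + j).val = v * u ^ i.val * u ^ j.val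
      rw [hadd, mul_assoc]
    · change u ^ ((n : ZMod (2 * n)) + j - i).val = v * u ^ i.val * (v * u ^ j.val)
      rw [mul_assoc, hswap, ← mul_assoc, add_sub_assoc, hadd, hn]

/-- The algebra homomorphism out of the group algebra of the dicyclic group determined by images
`u` of `a 1` and `v` of `xa 0` satisfying the defining relations. -/
noncomputable def liftAlgHom {n : ℕ} [NeZero n] (R : Type*) {A : Type*} [CommSemiring R]
    [Semiring A] [Algebra R A] (u v : A) (hu : u ^ (2 * n) = 1) (hv : v * v = u ^ n)
    (huv : u * v * u = v) : MonoidAlgebra R (QuaternionGroup n) →ₐ[R] A :=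
  MonoidAlgebra.lift R A _ (liftHom u v hu hv huv)

theorem sum_univ {n : ℕ} [NeZero n] {M : Type*} [AddCommMonoid M] (f : QuaternionGroup n → M) :
    ∑ g, f g = ∑ i, f (a i) + ∑ i, f (xa i) := by
  let e : ZMod (2 * n) ⊕ ZMod (2 * n) ≃ QuaternionGroup n :=
    { toFun := Sum.elim a xa
      invFun := fun | a i => .inl i | xa i => .inr i
      left_inv := by rintro (i | i) <;> rfl
      right_inv := by rintro (i | i) <;> rfl }
  rw [← e.sum_comp, Fintype.sum_sum_type]
  rfl

theorem liftAlgHom_apply {n : ℕ} [NeZero n] {R A : Type*} [CommSemiring R]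
    [Semiring A] [Algebra R A] {u v : A} (hu : u ^ (2 * n) = 1) (hv : v * v = u ^ n)
    (huv : u * v * u = v) (f : MonoidAlgebra R (QuaternionGroup n)) :
    liftAlgHom R u v hu hv huv f =
      ∑ i, f.coeff (a i) • u ^ i.val + ∑ i, f.coeff (xa i) • (v * u ^ i.val) := by
  rw [liftAlgHom, MonoidAlgebra.lift_apply, Finsupp.sum_fintype _ _ (by simp), sum_univ]
  rfl

end QuaternionGroup

/-- A square root of `-1` in a field extension of `ℚ` is linearly independent from `1`. -/
theorem Rat.eq_zero_of_algebraMap_add_mul_eq_zero {K : Type*} [Field K] [Algebra ℚ K] {ζ : K}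
    (hζ : ζ * ζ = -1) {p q : ℚ} (h : algebraMap ℚ K p + algebraMap ℚ K q * ζ = 0) :
    p = 0 ∧ q = 0 := by
  have hpq : algebraMap ℚ K (p ^ 2 + q ^ 2) = 0 := by
    simp only [map_add, map_pow]
    linear_combination
      (algebraMap ℚ K p - algebraMap ℚ K q * ζ) * h + (algebraMap ℚ K q) ^ 2 * hζ
  rw [map_eq_zero] at hpq
  constructor <;> nlinarith [sq_nonneg p, sq_nonneg q]

/-- Wedderburn decomposition
`ℚ[Dic₃] ≅ ℚ × ℚ × ℚ(i) × (−1,−3/ℚ) × M₂(ℚ)` as ℚ-algebras, where `QuaternionGroup 3`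
is the dicyclic group of order 12 and `ℍ[ℚ,-1,-3]` is the quaternion algebra with
`i² = −1`, `j² = −3`. -/
theorem stmt_18 :
    Nonempty (MonoidAlgebra ℚ (QuaternionGroup 3) ≃ₐ[ℚ]
      ℚ × ℚ × CyclotomicField 4 ℚ × ℍ[ℚ, -1, -3] × Matrix (Fin 2) (Fin 2) ℚ) := by
  have hcyc : IsCyclotomicExtension {4} ℚ (CyclotomicField 4 ℚ) :=
    CyclotomicField.isCyclotomicExtension 4 ℚ
  obtain ⟨ζ, hζ⟩ : ∃ ζ : CyclotomicField 4 ℚ, ζ * ζ = -1 := by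
    have h := (IsCyclotomicExtension.zeta_spec 4 ℚ (CyclotomicField 4 ℚ)).pow
      (by norm_num) (show 4 = 2 * 2 by norm_num)
    exact ⟨_, (sq _).symm.trans h.eq_neg_one_of_two_right⟩
  let w : ℍ[ℚ, -1, -3] := ⟨1 / 2, 0, 1 / 2, 0⟩
  have hw2 : w ^ 2 = ⟨-1 / 2, 0, 1 / 2, 0⟩ := by
    ext <;> simp [w, sq] <;> norm_num
  have hw3 : w ^ 3 = -1 := by
    rw [pow_succ, hw2]
    ext <;> simp [w] <;> norm_num
  let x : ℍ[ℚ, -1, -3] := ⟨0, 1, 0, 0⟩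
  let s : Matrix (Fin 2) (Fin 2) ℚ := !![0, -1; 1, -1]
  have hs2 : s ^ 2 = !![-1, 1; -1, 0] := by simp [s, sq]
  have hs3 : s ^ 3 = 1 := by
    rw [pow_succ, hs2]
    simp [s, Matrix.one_fin_two]
  let t : Matrix (Fin 2) (Fin 2) ℚ := !![0, 1; 1, 0]
  have hw4 : w ^ 4 = -w := by rw [pow_succ, hw3, neg_one_mul]
  have hw5 : w ^ 5 = -w ^ 2 := by rw [pow_add w 3 2, hw3, neg_one_mul]
  have hs4 : s ^ 4 = s := by rw [pow_succ, hs3, one_mul]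
  have hs5 : s ^ 5 = s ^ 2 := by rw [pow_add s 3 2, hs3, one_mul]
  let φ := (QuaternionGroup.liftAlgHom (n := 3) ℚ (1 : ℚ) 1 (by simp) (by simp) (by simp)).prod <|
    (QuaternionGroup.liftAlgHom (n := 3) ℚ (1 : ℚ) (-1) (by simp) (by simp) (by simp)).prod <|
    (QuaternionGroup.liftAlgHom (n := 3) ℚ (-1) ζ (by norm_num) (by rw [hζ]; norm_num)
      (by simp)).prod <|
    (QuaternionGroup.liftAlgHom (n := 3) ℚ w x (by rw [mul_comm, pow_mul, hw3]; simp)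
      (by rw [hw3]; ext <;> simp [x]) (by ext <;> norm_num [x, w])).prod <|
    QuaternionGroup.liftAlgHom (n := 3) ℚ s t (by rw [mul_comm, pow_mul, hs3]; simp)
      (by rw [hs3]; simp [t, Matrix.one_fin_two]) (by simp [s, t])
  have hinj : Function.Injective φ := by
    rw [injective_iff_map_eq_zero]
    intro f hf
    have hsum {M : Type} [AddCommMonoid M] (g : ZMod (2 * 3) → M) :
        ∑ i, g i = g 0 + g 1 + g 2 + g 3 + g 4 + g 5 := Fin.sum_univ_six g
    have v0 : ZMod.val (0 : ZMod (2 * 3)) = 0 := rfl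
    have v1 : ZMod.val (1 : ZMod (2 * 3)) = 1 := rfl
    have v2 : ZMod.val (2 : ZMod (2 * 3)) = 2 := rfl
    have v3 : ZMod.val (3 : ZMod (2 * 3)) = 3 := rfl
    have v4 : ZMod.val (4 : ZMod (2 * 3)) = 4 := rfl
    have v5 : ZMod.val (5 : ZMod (2 * 3)) = 5 := rfl
    simp only [φ, AlgHom.prod_apply, Prod.mk_eq_zero, QuaternionGroup.liftAlgHom_apply,
      hsum, v0, v1, v2, v3, v4, v5, pow_zero, pow_one, hw2, hw3, hw4, hw5,
      hs2, hs3, hs4, hs5, one_pow, mul_one, smul_eq_mul] at hf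
    obtain ⟨h1, h2, h3, h4, h5⟩ := hf
    have h4re := congrArg QuaternionAlgebra.re h4
    have h4i := congrArg QuaternionAlgebra.imI h4
    have h4j := congrArg QuaternionAlgebra.imJ h4
    have h4k := congrArg QuaternionAlgebra.imK h4
    simp [w, x, -QuaternionGroup.a_zero] at h4re h4i h4j h4k
    have h500 := congrFun₂ h5 0 0
    have h501 := congrFun₂ h5 0 1
    have h510 := congrFun₂ h5 1 0
    have h511 := congrFun₂ h5 1 1
    simp [s, t, -QuaternionGroup.a_zero] at h500 h501 h510 h511
    obtain ⟨h3re, h3im⟩ := Rat.eq_zero_of_algebraMap_add_mul_eq_zero hζ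
      (p := f.coeff (.a 0) - f.coeff (.a 1) + f.coeff (.a 2) - f.coeff (.a 3) + f.coeff (.a 4)
        - f.coeff (.a 5))
      (q := f.coeff (.xa 0) - f.coeff (.xa 1) + f.coeff (.xa 2) - f.coeff (.xa 3)
        + f.coeff (.xa 4) - f.coeff (.xa 5)) (by
        simp only [Algebra.smul_def] at h3
        simp only [map_add, map_sub]
        linear_combination h3)
    clear h3 h4 h5
    ext (i | i) <;> change Fin 6 at i <;> fin_cases i
    · change f.coeff (.a 0) = 0
      linarith
    · change f.coeff (.a 1) = 0
      linarith
    · change f.coeff (.a 2) = 0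
      linarith
    · change f.coeff (.a 3) = 0
      linarith
    · change f.coeff (.a 4) = 0
      linarith
    · change f.coeff (.a 5) = 0
      linarith
    · change f.coeff (.xa 0) = 0
      linarith
    · change f.coeff (.xa 1) = 0
      linarith
    · change f.coeff (.xa 2) = 0
      linarith
    · change f.coeff (.xa 3) = 0
      linarith
    · change f.coeff (.xa 4) = 0
      linarith
    · change f.coeff (.xa 5) = 0
      linarith
  have hfin : Module.finrank ℚ (MonoidAlgebra ℚ (QuaternionGroup 3)) = Module.finrank ℚ
      (ℚ × ℚ × CyclotomicField 4 ℚ × ℍ[ℚ, -1, -3] × Matrix (Fin 2) (Fin 2) ℚ) := by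
    rw [(MonoidAlgebra.coeffLinearEquiv ℚ).finrank_eq, Module.finrank_finsupp_self,
      QuaternionGroup.card]
    simp only [Module.finrank_prod, QuaternionAlgebra.finrank_eq_four, Module.finrank_self,
      IsCyclotomicExtension.Rat.finrank 4 (CyclotomicField 4 ℚ), Module.finrank_matrix,
      Fintype.card_fin]
    rfl
  have : FiniteDimensional ℚ (CyclotomicField 4 ℚ) :=
    IsCyclotomicExtension.finiteDimensional {4} ℚ _
  have hsurj : Function.Surjective φ :=
    (LinearMap.injective_iff_surjective_of_finrank_eq_finrank hfin (f := φ.toLinearMap)).1 hinj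
  exact ⟨AlgEquiv.ofBijective φ ⟨hinj, hsurj⟩⟩
end
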